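/- (Poincaré–Miranda theorem.) Let n ≥ 1, let Q^n = [−1,1]^n ⊆ ℝ^n, and let q : Q^n → ℝ^n be continuous. Suppose that for every i ∈ {1,…,n}: q_i(x) ≥ 0 for all x ∈ Q^n with x_i = 1, and q_i(x) ≤ 0 for all x ∈ Q^n with x_i = −1. Then there exists x ∈ Q^n with q(x) = 0. -/

import Mathlib

noncomputable section

/-- The determinant as a continuous multilinear function of the rows. -/
def detContinuousMultilinearMap (ι : Type*) [Fintype ι] [DecidableEq ι] :
    ContinuousMultilinearMap ℝ (fun _ : ι => ι → ℝ) ℝ where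
  toMultilinearMap := (Matrix.detRowAlternating (n := ι) (R := ℝ)).toMultilinearMap
  cont := Continuous.matrix_det (A := fun M : Matrix ι ι ℝ => M) continuous_id

/-- The vector of partial derivatives of `g` at `x`. -/
def partialDerivs {ι : Type*} [Fintype ι] [DecidableEq ι] (g : (ι → ℝ) → ℝ) (x : ι → ℝ) : ι → ℝ :=
  fun l => fderiv ℝ g x (Pi.single l 1)

/-- The Jacobian matrix of the family `f` at `x`. -/
def jacobianMatrix {ι : Type*} [Fintype ι] [DecidableEq ι] (f : ι → (ι → ℝ) → ℝ) (x : ι → ℝ) :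
    Matrix ι ι ℝ :=
  Matrix.of fun k => partialDerivs (f k) x

section Algebra

variable {ι : Type*} [Fintype ι] [DecidableEq ι]

lemma det_updateRow_eq_sum_mul_adjugate (M : Matrix ι ι ℝ) (j : ι) (b : ι → ℝ) :
    (M.updateRow j b).det = ∑ i, b i * M.adjugate i j := by
  rw [Matrix.det_eq_sum_mul_adjugate_row _ j]
  simp [Matrix.adjugate_apply]

/-- Antisymmetry of the determinant kills its contraction with a symmetric matrix. -/
lemma sum_det_updateRow_symm_eq_zero (M : Matrix ι ι ℝ) {j k : ι} (hjk : k ≠ j)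
    (H : ι → ι → ℝ) (hH : ∀ i l, H i l = H l i) :
    ∑ i, ((M.updateRow j (Pi.single i 1)).updateRow k (H i)).det = 0 := by
  set D : ι → ι → ℝ := fun i l =>
    ((M.updateRow j (Pi.single i 1)).updateRow k (Pi.single l 1)).det with hD
  have hanti : ∀ i l, D i l = - D l i := by
    intro i l
    have := Matrix.det_permute (Equiv.swap j k)
      ((M.updateRow j (Pi.single i 1)).updateRow k (Pi.single l 1))
    rw [Equiv.Perm.sign_swap hjk.symm] at this
    simp only [hD]
    have h2 : ((M.updateRow j (Pi.single i 1)).updateRow k (Pi.single l 1)).submatrix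
        (Equiv.swap j k) id = (M.updateRow j (Pi.single l 1)).updateRow k (Pi.single i 1) := by
      ext a b
      simp only [Matrix.submatrix_apply, Matrix.updateRow_apply, Equiv.swap_apply_def, id]
      split_ifs <;> simp_all
    rw [h2] at this
    simp [this]
  have hexp : ∀ i, ((M.updateRow j (Pi.single i 1)).updateRow k (H i)).det
      = ∑ l, H i l * D i l := by
    intro i
    rw [det_updateRow_eq_sum_mul_adjugate]
    simp [hD, Matrix.adjugate_apply]
  simp_rw [hexp]
  have hswap : ∑ i, ∑ l, H i l * D i l = - ∑ i, ∑ l, H i l * D i l := by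
    conv_lhs => rw [Finset.sum_comm]
    rw [← Finset.sum_neg_distrib]
    refine Finset.sum_congr rfl fun i _ => ?_
    rw [← Finset.sum_neg_distrib]
    refine Finset.sum_congr rfl fun l _ => ?_
    rw [hH l i, hanti l i]; ring
  linarith

end Algebra

section Calculus

variable {ι : Type*} [Fintype ι] [DecidableEq ι]

lemma contDiff_partialDerivs {g : (ι → ℝ) → ℝ} (hg : ContDiff ℝ 2 g) :
    ContDiff ℝ 1 (partialDerivs g) :=
  contDiff_pi.2 fun _ => (hg.fderiv_right (by norm_num)).clm_apply contDiff_const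

lemma adjugate_jacobianMatrix_eq (f : ι → (ι → ℝ) → ℝ) (i j : ι) (x : ι → ℝ) :
    (jacobianMatrix f x).adjugate i j = detContinuousMultilinearMap ι
      (fun k => if k = j then Pi.single i 1 else partialDerivs (f k) x) := by
  rw [Matrix.adjugate_apply]
  change Matrix.det _ = Matrix.det _
  congr 1
  ext a b
  by_cases h : a = j <;> simp [Matrix.updateRow_apply, jacobianMatrix, h]

lemma contDiff_adjugate_jacobianMatrix {f : ι → (ι → ℝ) → ℝ} (hf : ∀ k, ContDiff ℝ 2 (f k))
    (i j : ι) : ContDiff ℝ 1 fun x => (jacobianMatrix f x).adjugate i j := by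
  simp_rw [adjugate_jacobianMatrix_eq]
  refine (detContinuousMultilinearMap ι).contDiff.comp (contDiff_pi.2 fun k => ?_)
  by_cases h : k = j
  · simpa [h] using contDiff_const
  · simpa [h] using contDiff_partialDerivs (hf k)

lemma fderiv_partialDerivs_apply {g : (ι → ℝ) → ℝ} (hg : ContDiff ℝ 2 g) (x v : ι → ℝ) (l : ι) :
    fderiv ℝ (partialDerivs g) x v l = fderiv ℝ (fderiv ℝ g) x v (Pi.single l 1) := by
  have hd : DifferentiableAt ℝ (fderiv ℝ g) x :=
    (hg.fderiv_right (m := 1) (by norm_num)).differentiable one_ne_zero x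
  have : HasFDerivAt (partialDerivs g)
      (ContinuousLinearMap.pi fun l =>
        (ContinuousLinearMap.apply ℝ ℝ (Pi.single l (1 : ℝ))).comp (fderiv ℝ (fderiv ℝ g) x)) x :=
    hasFDerivAt_pi.2 fun l => HasFDerivAt.comp x
      (g := ContinuousLinearMap.apply ℝ ℝ (Pi.single l (1 : ℝ) : ι → ℝ))
      (ContinuousLinearMap.hasFDerivAt _) hd.hasFDerivAt
  rw [this.fderiv]
  simp

/-- **Piola identity**: the cofactors of a Jacobian matrix along a row are divergence free. -/
lemma sum_fderiv_adjugate_jacobianMatrix {f : ι → (ι → ℝ) → ℝ} (hf : ∀ k, ContDiff ℝ 2 (f k))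
    (j : ι) (x : ι → ℝ) :
    ∑ i, fderiv ℝ (fun y => (jacobianMatrix f y).adjugate i j) x (Pi.single i 1) = 0 := by
  have hderiv : ∀ i, fderiv ℝ (fun y => (jacobianMatrix f y).adjugate i j) x (Pi.single i 1) =
      ∑ k, if k = j then 0 else (((jacobianMatrix f x).updateRow j (Pi.single i 1)).updateRow k
        (fderiv ℝ (partialDerivs (f k)) x (Pi.single i 1))).det := by
    intro i
    simp_rw [adjugate_jacobianMatrix_eq]
    have hrow : ∀ k, HasFDerivAt
        (fun y => if k = j then (Pi.single i 1 : ι → ℝ) else partialDerivs (f k) y)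
        (if k = j then 0 else fderiv ℝ (partialDerivs (f k)) x) x := by
      intro k
      by_cases h : k = j
      · simpa [h] using hasFDerivAt_const (𝕜 := ℝ) (Pi.single i 1 : ι → ℝ) x
      · simpa [h] using
          ((contDiff_partialDerivs (hf k)).differentiable one_ne_zero x).hasFDerivAt
    rw [(HasFDerivAt.multilinear_comp (detContinuousMultilinearMap ι) hrow).fderiv]
    simp only [_root_.sum_apply, ContinuousLinearMap.comp_apply]
    refine Finset.sum_congr rfl fun k _ => ?_
    by_cases h : k = j
    · simp only [h, if_true, _root_.zero_apply, map_zero]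
    · simp only [h, if_false]
      change Matrix.det _ = _
      congr 1
      ext a b
      by_cases hak : a = k
      · subst hak; simp
      · by_cases haj : a = j
        · subst haj; simp [Matrix.updateRow_apply, hak]
        · simp [Matrix.updateRow_apply, hak, haj, jacobianMatrix]
  simp_rw [hderiv]
  rw [Finset.sum_comm]
  refine Finset.sum_eq_zero fun k _ => ?_
  by_cases h : k = j
  · simp [h]
  · simp only [h, if_false]
    refine sum_det_updateRow_symm_eq_zero _ h _ fun i l => ?_
    rw [fderiv_partialDerivs_apply (hf k), fderiv_partialDerivs_apply (hf k)]
    exact ((hf k).contDiffAt.isSymmSndFDerivAt (by simp)) _ _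

end Calculus

open MeasureTheory in
/-- The Jacobian determinant integrates to zero over the cube if one function vanishes on its
pair of opposite facets and every other one has normal gradient on its own pair of facets. -/
lemma integral_det_updateRow_jacobianMatrix_eq_zero {m : ℕ}
    {f : Fin (m + 1) → (Fin (m + 1) → ℝ) → ℝ} (hf : ∀ k, ContDiff ℝ 2 (f k))
    {h : (Fin (m + 1) → ℝ) → ℝ} (hh : ContDiff ℝ 1 h) (j : Fin (m + 1))
    (hhj : ∀ x ∈ Set.Icc (-1 : Fin (m + 1) → ℝ) 1, x j = 1 ∨ x j = -1 → h x = 0)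
    (hfi : ∀ i ≠ j, ∀ x ∈ Set.Icc (-1 : Fin (m + 1) → ℝ) 1, x i = 1 ∨ x i = -1 →
      ∀ l ≠ i, partialDerivs (f i) x l = 0) :
    ∫ x in Set.Icc (-1 : Fin (m + 1) → ℝ) 1,
      ((jacobianMatrix f x).updateRow j (partialDerivs h x)).det = 0 := by
  set V : Fin (m + 1) → (Fin (m + 1) → ℝ) → ℝ :=
    fun i x => h x * (jacobianMatrix f x).adjugate i j with hV
  have hVc : ∀ i, ContDiff ℝ 1 (V i) := fun i => hh.mul (contDiff_adjugate_jacobianMatrix hf i j)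
  have hdiv : ∀ x, ∑ i, fderiv ℝ (V i) x (Pi.single i 1) =
      ((jacobianMatrix f x).updateRow j (partialDerivs h x)).det := by
    intro x
    rw [det_updateRow_eq_sum_mul_adjugate]
    have hprod : ∀ i, fderiv ℝ (V i) x (Pi.single i 1) =
        h x * fderiv ℝ (fun y => (jacobianMatrix f y).adjugate i j) x (Pi.single i 1) +
          partialDerivs h x i * (jacobianMatrix f x).adjugate i j := by
      intro i
      rw [hV, fderiv_fun_mul (hh.differentiable one_ne_zero x)
        ((contDiff_adjugate_jacobianMatrix hf i j).differentiable one_ne_zero x)]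
      simp [partialDerivs, mul_comm]
    simp_rw [hprod, Finset.sum_add_distrib, ← Finset.mul_sum,
      sum_fderiv_adjugate_jacobianMatrix hf]
    simp
  have hface : ∀ i, ∀ x ∈ Set.Icc (-1 : Fin (m + 1) → ℝ) 1, x i = 1 ∨ x i = -1 → V i x = 0 := by
    intro i x hx hxi
    by_cases hij : i = j
    · subst hij
      simp [hV, hhj x hx hxi]
    · have hrow : partialDerivs (f i) x = partialDerivs (f i) x i • Pi.single i 1 := by
        ext l
        by_cases hl : l = i
        · subst hl; simp
        · simp [hl, hfi i hij x hx hxi l hl]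
      have : (jacobianMatrix f x).adjugate i j = 0 := by
        rw [Matrix.adjugate_apply]
        have h1 : ((jacobianMatrix f x).updateRow j (Pi.single i 1)) =
            ((jacobianMatrix f x).updateRow j (Pi.single i 1)).updateRow i
              (partialDerivs (f i) x i • Pi.single i 1) := by
          rw [← hrow]
          ext a b
          by_cases ha : a = i
          · subst ha; simp [Matrix.updateRow_apply, hij, jacobianMatrix]
          · simp [Matrix.updateRow_apply, ha]
        rw [h1, Matrix.det_updateRow_smul]
        rw [Matrix.det_zero_of_row_eq hij, mul_zero]
        simp [Matrix.updateRow_ne (Ne.symm hij)]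
      simp [hV, this]
  simp_rw [← hdiv]
  rw [integral_divergence_of_hasFDerivAt_off_countable' (-1) 1
    (by intro i; simp) V (fun i x => fderiv ℝ (V i) x) ∅ Set.countable_empty
    (fun i => (hVc i).continuous.continuousOn)
    (fun x _ i => ((hVc i).differentiable one_ne_zero x).hasFDerivAt)]
  · refine Finset.sum_eq_zero fun i _ => ?_
    have hmem : ∀ c ∈ Set.Icc (-1 : ℝ) 1, ∀ y ∈ Set.Icc ((-1 : Fin (m + 1) → ℝ) ∘ i.succAbove)
        ((1 : Fin (m + 1) → ℝ) ∘ i.succAbove),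
        (i.insertNth c y : Fin (m + 1) → ℝ) ∈ Set.Icc (-1 : Fin (m + 1) → ℝ) 1 := by
      intro c hc y hy
      rw [Fin.insertNth_mem_Icc]
      exact ⟨hc, hy⟩
    rw [setIntegral_eq_zero_of_forall_eq_zero, setIntegral_eq_zero_of_forall_eq_zero, sub_zero]
    · exact fun y hy => hface i _ (hmem _ (by simp) y hy) (by simp)
    · exact fun y hy => hface i _ (hmem _ (by simp) y hy) (by simp)
  · refine Continuous.integrableOn_Icc (continuous_finsetSum _ fun i _ => ?_)
    exact ((hVc i).continuous_fderiv one_ne_zero).clm_apply continuous_const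

/-- A family of `C²` functions such that the `i`-th one coincides with the `i`-th coordinate, and
has normal gradient, on the two facets of the cube `[-1, 1]ⁿ` orthogonal to the `i`-th axis. -/
structure FacetAdapted {n : ℕ} (f : Fin n → (Fin n → ℝ) → ℝ) : Prop where
  contDiff : ∀ i, ContDiff ℝ 2 (f i)
  eq_coord : ∀ i, ∀ x ∈ Set.Icc (-1 : Fin n → ℝ) 1, x i = 1 ∨ x i = -1 → f i x = x i
  partialDerivs_eq_zero : ∀ i, ∀ x ∈ Set.Icc (-1 : Fin n → ℝ) 1, x i = 1 ∨ x i = -1 →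
    ∀ l ≠ i, partialDerivs (f i) x l = 0

lemma partialDerivs_coord {n : ℕ} (i : Fin n) (x : Fin n → ℝ) :
    partialDerivs (fun y : Fin n → ℝ => y i) x = Pi.single i 1 := by
  ext l
  have : HasFDerivAt (fun y : Fin n → ℝ => y i) (ContinuousLinearMap.proj (R := ℝ) i) x :=
    hasFDerivAt_apply i x
  simp only [partialDerivs, this.fderiv, ContinuousLinearMap.proj_apply]
  simp [Pi.single_apply, eq_comm]

lemma FacetAdapted.update_coord {n : ℕ} {f : Fin n → (Fin n → ℝ) → ℝ} (hf : FacetAdapted f)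
    (j : Fin n) : FacetAdapted (Function.update f j fun y => y j) where
  contDiff i := by
    by_cases h : i = j
    · subst h; simpa using contDiff_apply ℝ ℝ i
    · simpa [h] using hf.contDiff i
  eq_coord i x hx hxi := by
    by_cases h : i = j
    · subst h; simp
    · simpa [h] using hf.eq_coord i x hx hxi
  partialDerivs_eq_zero i x hx hxi l hl := by
    by_cases h : i = j
    · subst h; simp [partialDerivs_coord, hl]
    · simpa [h] using hf.partialDerivs_eq_zero i x hx hxi l hl

lemma continuous_det_jacobianMatrix {n : ℕ} {f : Fin n → (Fin n → ℝ) → ℝ}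
    (hf : ∀ i, ContDiff ℝ 2 (f i)) : Continuous fun x => (jacobianMatrix f x).det :=
  Continuous.matrix_det <| continuous_pi fun i => (contDiff_partialDerivs (hf i)).continuous

open MeasureTheory in
lemma FacetAdapted.integral_det_update_coord {m : ℕ} {f : Fin (m + 1) → (Fin (m + 1) → ℝ) → ℝ}
    (hf : FacetAdapted f) (j : Fin (m + 1)) :
    ∫ x in Set.Icc (-1 : Fin (m + 1) → ℝ) 1,
      (jacobianMatrix (Function.update f j fun y => y j) x).det =
    ∫ x in Set.Icc (-1 : Fin (m + 1) → ℝ) 1, (jacobianMatrix f x).det := by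
  have hc : ContDiff ℝ 2 fun y : Fin (m + 1) → ℝ => y j := contDiff_apply ℝ ℝ j
  have hzero := integral_det_updateRow_jacobianMatrix_eq_zero hf.contDiff
    (h := fun y => y j - f j y) ((hc.sub (hf.contDiff j)).of_le (by norm_num)) j
    (fun x hx hxj => by simp [hf.eq_coord j x hx hxj])
    (fun i _ => hf.partialDerivs_eq_zero i)
  rw [← sub_eq_zero, ← integral_sub
    (continuous_det_jacobianMatrix (hf.update_coord j).contDiff).integrableOn_Icc
    (continuous_det_jacobianMatrix hf.contDiff).integrableOn_Icc, ← hzero]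
  congr 1
  ext x
  have hu : jacobianMatrix (Function.update f j fun y => y j) x =
      (jacobianMatrix f x).updateRow j (partialDerivs (fun y => y j) x) := by
    ext a b
    by_cases ha : a = j
    · subst ha; simp [jacobianMatrix]
    · simp [jacobianMatrix, ha, Matrix.updateRow_apply]
  have hs : partialDerivs (fun y : Fin (m + 1) → ℝ => y j) x =
      partialDerivs (fun y => y j - f j y) x + partialDerivs (f j) x := by
    ext l
    have := fderiv_fun_sub (hc.differentiable two_ne_zero x)
      ((hf.contDiff j).differentiable two_ne_zero x)
    simp [partialDerivs, this]
  have hself : (jacobianMatrix f x).updateRow j (partialDerivs (f j) x) = jacobianMatrix f x :=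
    Matrix.updateRow_eq_self _ j
  rw [hu, hs, Matrix.det_updateRow_add, hself]
  ring

open MeasureTheory in
lemma FacetAdapted.integral_det_jacobianMatrix {m : ℕ}
    {f : Fin (m + 1) → (Fin (m + 1) → ℝ) → ℝ} (hf : FacetAdapted f) :
    ∫ x in Set.Icc (-1 : Fin (m + 1) → ℝ) 1, (jacobianMatrix f x).det = 2 ^ (m + 1) := by
  have key : ∀ s : Finset (Fin (m + 1)),
      FacetAdapted (fun i => if i ∈ s then fun y => y i else f i) ∧
      ∫ x in Set.Icc (-1 : Fin (m + 1) → ℝ) 1,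
        (jacobianMatrix (fun i => if i ∈ s then fun y => y i else f i) x).det =
      ∫ x in Set.Icc (-1 : Fin (m + 1) → ℝ) 1, (jacobianMatrix f x).det := by
    intro s
    induction s using Finset.induction_on with
    | empty => simpa using hf
    | insert j s _ ih =>
      have hupd : (fun i => if i ∈ insert j s then fun y : Fin (m + 1) → ℝ => y i else f i) =
          Function.update (fun i => if i ∈ s then fun y => y i else f i) j fun y => y j := by
        ext i y
        by_cases h : i = j
        · subst h; simp
        · simp [h]
      rw [hupd]
      exact ⟨ih.1.update_coord j, (ih.1.integral_det_update_coord j).trans ih.2⟩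
  rw [← (key Finset.univ).2]
  have hone : ∀ x, jacobianMatrix (fun i : Fin (m + 1) =>
      if i ∈ Finset.univ then fun y : Fin (m + 1) → ℝ => y i else f i) x = 1 := by
    intro x
    ext a b
    simp [jacobianMatrix, partialDerivs_coord, Matrix.one_apply, Pi.single_apply, eq_comm]
  simp_rw [hone]
  simp [Measure.real, Real.volume_Icc_pi]
  norm_num

/-- A family of facet-adapted functions has a nonsingular Jacobian matrix somewhere in the cube. -/
lemma FacetAdapted.exists_det_ne_zero {m : ℕ} {f : Fin (m + 1) → (Fin (m + 1) → ℝ) → ℝ}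
    (hf : FacetAdapted f) :
    ∃ x ∈ Set.Icc (-1 : Fin (m + 1) → ℝ) 1, (jacobianMatrix f x).det ≠ 0 := by
  by_contra! hcon
  have h := hf.integral_det_jacobianMatrix
  rw [MeasureTheory.setIntegral_eq_zero_of_forall_eq_zero hcon] at h
  exact (pow_pos two_pos _).ne h

/-- A smooth function of `t`, equal to `-1` for `t ≤ -ε / 2` and to `1` for `t ≥ ε / 2`. -/
def smoothSign (ε t : ℝ) : ℝ := 2 * Real.smoothTransition (t / ε + 1 / 2) - 1

lemma smoothSign_of_ge {ε t : ℝ} (hε : 0 < ε) (ht : ε / 2 ≤ t) : smoothSign ε t = 1 := by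
  have : 1 / 2 ≤ t / ε := by rw [le_div_iff₀ hε]; linarith
  rw [smoothSign, Real.smoothTransition.one_of_one_le (by linarith)]
  norm_num

lemma smoothSign_of_le {ε t : ℝ} (hε : 0 < ε) (ht : t ≤ -(ε / 2)) : smoothSign ε t = -1 := by
  have : t / ε ≤ -(1 / 2) := by rw [div_le_iff₀ hε]; linarith
  rw [smoothSign, Real.smoothTransition.zero_of_nonpos (by linarith)]
  norm_num

lemma contDiff_smoothSign (ε : ℝ) : ContDiff ℝ 2 (smoothSign ε) :=
  (contDiff_const.mul ((Real.smoothTransition.contDiff (n := 2)).comp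
    ((contDiff_id.div_const ε).add contDiff_const))).sub contDiff_const

lemma partialDerivs_smoothSign_comp {n : ℕ} {ε : ℝ} (hε : 0 < ε) {p : (Fin n → ℝ) → ℝ}
    (hp : Continuous p) {x : Fin n → ℝ} (hx : ε / 2 < |p x|) :
    partialDerivs (fun y => smoothSign ε (p y)) x = 0 := by
  have hloc : ∃ c : ℝ, (fun y => smoothSign ε (p y)) =ᶠ[nhds x] fun _ => c := by
    rcases lt_abs.1 hx with h | h
    · refine ⟨1, ?_⟩
      filter_upwards [hp.continuousAt.eventually_const_lt h] with y hy
      exact smoothSign_of_ge hε hy.le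
    · refine ⟨-1, ?_⟩
      filter_upwards [hp.continuousAt.eventually_lt_const (lt_neg_of_lt_neg h)] with y hy
      exact smoothSign_of_le hε hy.le
  obtain ⟨c, hc⟩ := hloc
  ext l
  simp [partialDerivs, hc.fderiv_eq]

/-- Poincaré–Miranda for a continuous map defined on the whole space. -/
lemma exists_zero_of_continuous {m : ℕ} {q : (Fin (m + 1) → ℝ) → (Fin (m + 1) → ℝ)}
    (hq : Continuous q)
    (hpos : ∀ i, ∀ x ∈ Set.Icc (-1 : Fin (m + 1) → ℝ) 1, x i = 1 → 0 ≤ q x i)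
    (hneg : ∀ i, ∀ x ∈ Set.Icc (-1 : Fin (m + 1) → ℝ) 1, x i = -1 → q x i ≤ 0) :
    ∃ x ∈ Set.Icc (-1 : Fin (m + 1) → ℝ) 1, q x = 0 := by
  by_contra! hcon
  have hne : (Set.Icc (-1 : Fin (m + 1) → ℝ) 1).Nonempty := ⟨-1, le_rfl, fun i => by simp⟩
  obtain ⟨x₀, hx₀, hmin⟩ := isCompact_Icc.exists_isMinOn hne hq.norm.continuousOn
  obtain ⟨ε, hε, hε'⟩ : ∃ ε > 0, 2 * ε = ‖q x₀‖ :=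
    ⟨‖q x₀‖ / 2, half_pos (norm_pos_iff.2 (hcon x₀ hx₀)), by ring⟩
  obtain ⟨p, hp, hpq, -⟩ := Continuous.exists_contDiff_approx (f := fun x => q x + ε • x)
    (ε := fun _ => ε / 2) 2 (by fun_prop) continuous_const (fun _ => half_pos hε)
  have happrox : ∀ x i, |p x i - (q x i + ε * x i)| < ε / 2 := fun x i => by
    have := (dist_le_pi_dist (p x) (q x + ε • x) i).trans_lt (hpq x)
    simpa [Real.dist_eq] using this
  have hpi : ∀ i, ContDiff ℝ 2 fun x => p x i := fun i => contDiff_pi.1 hp i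
  have hface_pos : ∀ i, ∀ x ∈ Set.Icc (-1 : Fin (m + 1) → ℝ) 1, x i = 1 → ε / 2 < p x i := by
    intro i x hx hxi
    have h1 := (abs_lt.1 (happrox x i)).1
    have h2 := hpos i x hx hxi
    rw [hxi] at h1
    linarith
  have hface_neg : ∀ i, ∀ x ∈ Set.Icc (-1 : Fin (m + 1) → ℝ) 1, x i = -1 →
      p x i < -(ε / 2) := by
    intro i x hx hxi
    have h1 := (abs_lt.1 (happrox x i)).2
    have h2 := hneg i x hx hxi
    rw [hxi] at h1
    linarith
  have hadapted : FacetAdapted fun i x => smoothSign ε (p x i) :=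
    { contDiff := fun i => (contDiff_smoothSign ε).comp (hpi i)
      eq_coord := by
        rintro i x hx (hxi | hxi)
        · rw [hxi, smoothSign_of_ge hε (hface_pos i x hx hxi).le]
        · rw [hxi, smoothSign_of_le hε (hface_neg i x hx hxi).le]
      partialDerivs_eq_zero := by
        intro i x hx hxi l _
        rw [partialDerivs_smoothSign_comp hε (hpi i).continuous, Pi.zero_apply]
        rcases hxi with hxi | hxi
        · exact lt_abs.2 (Or.inl (hface_pos i x hx hxi))
        · exact lt_abs.2 (Or.inr (lt_neg_of_lt_neg (hface_neg i x hx hxi))) }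
  obtain ⟨x, hx, hdet⟩ := hadapted.exists_det_ne_zero
  refine hdet ?_
  obtain ⟨i, hi⟩ : ∃ i, 2 * ε ≤ |q x i| := by
    by_contra! hlt
    have : ‖q x‖ < 2 * ε := (pi_norm_lt_iff (by positivity)).2 hlt
    exact absurd (hmin hx) (by simpa [hε'] using this)
  refine Matrix.det_eq_zero_of_row_eq_zero i fun l => ?_
  have hx1 : |ε * x i| ≤ ε := by
    rw [abs_mul, abs_of_pos hε]
    exact mul_le_of_le_one_right hε.le (abs_le.2 ⟨hx.1 i, hx.2 i⟩)
  have hbig : ε / 2 < |p x i| := by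
    have h1 := happrox x i
    have h2 : |q x i| ≤ |p x i| + |p x i - (q x i + ε * x i)| + |ε * x i| := by
      have e : q x i = p x i - (p x i - (q x i + ε * x i)) - ε * x i := by ring
      calc |q x i| = |p x i - (p x i - (q x i + ε * x i)) - ε * x i| := by rw [← e]
        _ ≤ |p x i - (p x i - (q x i + ε * x i))| + |ε * x i| := abs_sub _ _
        _ ≤ _ := by gcongr; exact abs_sub _ _
    linarith
  exact congrFun (partialDerivs_smoothSign_comp hε (hpi i).continuous hbig) l

/-- **Poincaré–Miranda theorem.** Let `q : [-1,1]ⁿ → ℝⁿ` be continuous. If for each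
coordinate `i` the function `q_i` is nonnegative on the facet `x_i = 1` and nonpositive
on the facet `x_i = -1`, then `q` has a zero in the cube. -/
theorem poincare_miranda (n : ℕ) (hn : 1 ≤ n)
    (q : (Fin n → ℝ) → (Fin n → ℝ))
    (hq : ContinuousOn q (Set.univ.pi fun _ : Fin n => Set.Icc (-1 : ℝ) 1))
    (hpos : ∀ i : Fin n, ∀ x ∈ Set.univ.pi fun _ : Fin n => Set.Icc (-1 : ℝ) 1,
      x i = 1 → 0 ≤ q x i)
    (hneg : ∀ i : Fin n, ∀ x ∈ Set.univ.pi fun _ : Fin n => Set.Icc (-1 : ℝ) 1,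
      x i = -1 → q x i ≤ 0) :
    ∃ x ∈ Set.univ.pi fun _ : Fin n => Set.Icc (-1 : ℝ) 1, q x = 0 := by
  obtain ⟨m, rfl⟩ : ∃ m, n = m + 1 := ⟨n - 1, by omega⟩
  have hcube : (Set.univ.pi fun _ : Fin (m + 1) => Set.Icc (-1 : ℝ) 1) =
      Set.Icc (-1 : Fin (m + 1) → ℝ) 1 := Set.pi_univ_Icc _ _
  rw [hcube] at hq hpos hneg ⊢
  set r : (Fin (m + 1) → ℝ) → (Fin (m + 1) → ℝ) := fun x i => max (-1) (min 1 (x i)) with hr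
  have hrc : Continuous r := by fun_prop
  have hr_mem : ∀ x, r x ∈ Set.Icc (-1 : Fin (m + 1) → ℝ) 1 := fun x =>
    ⟨fun i => le_max_left _ _, fun i => max_le (by norm_num) (min_le_left _ _)⟩
  have hr_self : ∀ x ∈ Set.Icc (-1 : Fin (m + 1) → ℝ) 1, r x = x := fun x hx => by
    ext i
    have h1 : -1 ≤ x i := hx.1 i
    have h2 : x i ≤ 1 := hx.2 i
    simp only [hr]
    rw [min_eq_right h2, max_eq_right h1]
  obtain ⟨x, hx, hx0⟩ := exists_zero_of_continuous (q := q ∘ r)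
    (hq.comp_continuous hrc hr_mem)
    (fun i x hx hxi => by simpa [hr_self x hx] using hpos i x hx hxi)
    (fun i x hx hxi => by simpa [hr_self x hx] using hneg i x hx hxi)
  exact ⟨x, hx, by simpa [hr_self x hx] using hx0⟩
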